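/- Let d ≥ 2, p* := (d+2)/d, σ ∈ (0, 1/p*], α ≥ 1, and C > 0. Suppose that for every N ≥ 1, every finite orthonormal system (φ_j) in L²(𝕋^d) consisting of trigonometric polynomials with frequencies in {n ∈ ℤ^d : |n_1|,…,|n_d| ≤ N}, and every finite collection of nonnegative coefficients (a_j), one has ‖∑_j a_j |U(t)φ_j(x)|² − (2π)^{-d} ∑_j a_j‖_{L^{p*}_{t,x}([0,2π]×𝕋^d)} ≤ C N^σ (∑_j a_j^α)^{1/α}, where for a trigonometric polynomial φ = ∑_m c_m e_m one sets U(t)φ := ∑_m e^{−it|m|²} c_m e_m. Then 1/α ≥ 1 − σ/(d−1). -/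

import Mathlib

open MeasureTheory Complex
open scoped ENNReal

noncomputable section

/-- Lebesgue measure on the `d`-dimensional torus `𝕋^d = (ℝ/2πℤ)^d`,
realised as `[0, 2π)^d ⊂ ℝ^d`. -/
def torusMeasureD (d : ℕ) : Measure (Fin d → ℝ) :=
  Measure.pi fun _ => volume.restrict (Set.Ioc 0 (2 * Real.pi))

/-- The box of frequencies `{n ∈ ℤ^d : |n_1|, …, |n_d| ≤ N}`. -/
def boxD (d N : ℕ) : Finset (Fin d → ℤ) :=
  Fintype.piFinset fun _ => Finset.Icc (-(N : ℤ)) (N : ℤ)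

/-- The exponentials `e_n(x) = (2π)^{-d/2} e^{i n·x}` on `𝕋^d`. -/
def eFunD (d : ℕ) (n : Fin d → ℤ) (x : Fin d → ℝ) : ℂ :=
  (((2 * Real.pi) ^ (-(d : ℝ) / 2) : ℝ) : ℂ) *
    Complex.exp (((∑ i, (n i : ℝ) * x i : ℝ) : ℂ) * Complex.I)

/-- For a trigonometric polynomial `φ = ∑_{n ∈ box} c n · e_n`, this is
`U(t)φ = ∑_{n ∈ box} e^{-it|n|²} c n · e_n`; at `t = 0` it is `φ` itself. -/
def UtrigD (d N : ℕ) (c : (Fin d → ℤ) → ℂ) (t : ℝ) (x : Fin d → ℝ) : ℂ :=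
  ∑ n ∈ boxD d N,
    Complex.exp (((-(t * ∑ i, ((n i : ℝ)) ^ 2) : ℝ) : ℂ) * Complex.I) * c n * eFunD d n x

theorem integral_exp_int_mul_Ioc (k : ℤ) :
    ∫ x in Set.Ioc 0 (2 * Real.pi), Complex.exp (((k : ℝ) * x : ℝ) * Complex.I)
      = if k = 0 then (2 * Real.pi : ℂ) else 0 := by
  rw [← intervalIntegral.integral_of_le (by positivity)]
  split_ifs with hk
  · subst hk
    simp
  · have hc : (k : ℂ) * Complex.I ≠ 0 := by simp [hk]
    have h := integral_exp_mul_complex (a := 0) (b := 2 * Real.pi) hc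
    have h2 : Complex.exp ((k : ℂ) * Complex.I * ((2 * Real.pi : ℝ) : ℂ)) = 1 := by
      rw [Complex.exp_eq_one_iff]
      exact ⟨k, by push_cast; ring⟩
    rw [h2] at h
    simp only [ofReal_zero, mul_zero, Complex.exp_zero, sub_self, zero_div] at h
    rw [← h]
    congr 1
    ext x
    congr 1
    push_cast
    ring

instance (d : ℕ) : IsFiniteMeasure (torusMeasureD d) := by
  unfold torusMeasureD
  infer_instance

theorem continuous_eFunD (d : ℕ) (n : Fin d → ℤ) : Continuous (eFunD d n) := by
  unfold eFunD
  fun_prop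

theorem two_pi_rpow_sq (d : ℕ) :
    ((2 * Real.pi) ^ (-(d : ℝ) / 2)) ^ 2 = (2 * Real.pi) ^ (-(d : ℝ)) := by
  rw [← Real.rpow_natCast, ← Real.rpow_mul (by positivity)]
  congr 1
  push_cast
  ring

theorem conj_eFunD_mul (d : ℕ) (m n : Fin d → ℤ) (x : Fin d → ℝ) :
    (starRingEnd ℂ) (eFunD d m x) * eFunD d n x
      = (((2 * Real.pi) ^ (-(d : ℝ)) : ℝ) : ℂ)
        * ∏ i, Complex.exp ((((n i - m i : ℤ) : ℝ) * x i : ℝ) * Complex.I) := by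
  unfold eFunD
  rw [← Complex.exp_sum, map_mul, Complex.conj_ofReal, ← Complex.exp_conj, map_mul,
    Complex.conj_ofReal, Complex.conj_I, mul_mul_mul_comm, ← Complex.exp_add, ← two_pi_rpow_sq]
  congr 1
  · push_cast
    ring
  · congr 1
    push_cast
    rw [mul_neg, ← neg_mul, ← add_mul, ← Finset.sum_mul, ← Finset.sum_neg_distrib,
      ← Finset.sum_add_distrib]
    congr 1
    exact Finset.sum_congr rfl fun i _ => by ring

theorem integral_conj_eFunD_mul (d : ℕ) (m n : Fin d → ℤ) :
    ∫ x, (starRingEnd ℂ) (eFunD d m x) * eFunD d n x ∂torusMeasureD d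
      = if m = n then 1 else 0 := by
  simp_rw [conj_eFunD_mul]
  rw [integral_const_mul, torusMeasureD,
    integral_fintype_prod_eq_prod
      (fun i (y : ℝ) => Complex.exp ((((n i - m i : ℤ) : ℝ) * y : ℝ) * Complex.I))]
  simp_rw [integral_exp_int_mul_Ioc]
  split_ifs with h
  · subst h
    simp only [sub_self, if_true, Finset.prod_const, Finset.card_univ, Fintype.card_fin]
    rw [Real.rpow_neg (by positivity), Real.rpow_natCast]
    push_cast
    exact inv_mul_cancel₀ (pow_ne_zero _ (by simp [Real.pi_ne_zero]))
  · obtain ⟨i, hi⟩ := Function.ne_iff.mp h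
    rw [Finset.prod_eq_zero (Finset.mem_univ i), mul_zero]
    rw [if_neg]
    exact sub_ne_zero.mpr (Ne.symm hi)

theorem UtrigD_zero (d N : ℕ) (c : (Fin d → ℤ) → ℂ) (x : Fin d → ℝ) :
    UtrigD d N c 0 x = ∑ n ∈ boxD d N, c n * eFunD d n x := by
  simp [UtrigD]

theorem integrable_conj_eFunD_mul (d : ℕ) (m n : Fin d → ℤ) :
    Integrable (fun x => (starRingEnd ℂ) (eFunD d m x) * eFunD d n x) (torusMeasureD d) := by
  have hc : Continuous fun x => (starRingEnd ℂ) (eFunD d m x) * eFunD d n x :=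
    (Complex.continuous_conj.comp (continuous_eFunD d m)).mul (continuous_eFunD d n)
  refine Integrable.of_bound hc.aestronglyMeasurable ((2 * Real.pi) ^ (-(d : ℝ))) ?_
  refine Filter.Eventually.of_forall fun x => ?_
  rw [conj_eFunD_mul, norm_mul, norm_prod]
  simp_rw [Complex.norm_exp_ofReal_mul_I]
  simp only [Finset.prod_const_one, mul_one, Complex.norm_real, Real.norm_eq_abs]
  exact (abs_of_nonneg (by positivity)).le

theorem integral_conj_UtrigD_mul (d N : ℕ) (b c : (Fin d → ℤ) → ℂ) :
    ∫ x, (starRingEnd ℂ) (UtrigD d N b 0 x) * UtrigD d N c 0 x ∂torusMeasureD d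
      = ∑ n ∈ boxD d N, (starRingEnd ℂ) (b n) * c n := by
  have h : ∀ x, (starRingEnd ℂ) (UtrigD d N b 0 x) * UtrigD d N c 0 x
      = ∑ m ∈ boxD d N, ∑ n ∈ boxD d N,
        ((starRingEnd ℂ) (b m) * c n) * ((starRingEnd ℂ) (eFunD d m x) * eFunD d n x) := by
    intro x
    rw [UtrigD_zero, UtrigD_zero, map_sum, Finset.sum_mul_sum]
    refine Finset.sum_congr rfl fun m _ => Finset.sum_congr rfl fun n _ => ?_
    rw [map_mul]
    ring
  simp_rw [h]
  rw [integral_finsetSum _ fun m _ => integrable_finsetSum _ fun n _ =>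
    (integrable_conj_eFunD_mul d m n).const_mul _]
  refine Finset.sum_congr rfl fun m hm => ?_
  rw [integral_finsetSum _ fun n _ => (integrable_conj_eFunD_mul d m n).const_mul _]
  simp_rw [integral_const_mul, integral_conj_eFunD_mul]
  simp [hm]

/-- Coefficients of the normalised sum of the two exponentials with frequencies `(0, m)` and
`(1, m)`. -/
def pairCoeff (k : ℕ) (m : Fin k → ℤ) (n : Fin (k + 1) → ℤ) : ℂ :=
  ((√2)⁻¹ : ℝ) * ((if n = Fin.cons 0 m then 1 else 0) + if n = Fin.cons 1 m then 1 else 0)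

theorem cons_mem_boxD {k N : ℕ} {a : ℤ} {m : Fin k → ℤ} (ha : a ∈ Finset.Icc (-(N : ℤ)) N)
    (hm : m ∈ boxD k N) : (Fin.cons a m : Fin (k + 1) → ℤ) ∈ boxD (k + 1) N := by
  rw [boxD, Fintype.mem_piFinset] at hm ⊢
  intro i
  refine Fin.cases ?_ (fun i => ?_) i
  · simpa using ha
  · simpa using hm i

theorem card_boxD (k N : ℕ) : (boxD k N).card = (2 * N + 1) ^ k := by
  rw [boxD, Fintype.card_piFinset]
  simp only [Int.card_Icc, Finset.prod_const, Finset.card_univ, Fintype.card_fin]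
  congr 1
  omega

theorem sum_mul_pairCoeff {k N : ℕ} (hN : 1 ≤ N) {m : Fin k → ℤ} (hm : m ∈ boxD k N)
    (f : (Fin (k + 1) → ℤ) → ℂ) :
    ∑ n ∈ boxD (k + 1) N, f n * pairCoeff k m n
      = ((√2)⁻¹ : ℝ) * (f (Fin.cons 0 m) + f (Fin.cons 1 m)) := by
  have h0 : (Fin.cons 0 m : Fin (k + 1) → ℤ) ∈ boxD (k + 1) N :=
    cons_mem_boxD (by simp) hm
  have h1 : (Fin.cons 1 m : Fin (k + 1) → ℤ) ∈ boxD (k + 1) N :=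
    cons_mem_boxD (by rw [Finset.mem_Icc]; omega) hm
  have : ∀ n, f n * pairCoeff k m n = ((√2)⁻¹ : ℝ) *
      ((if n = Fin.cons 0 m then f n else 0) + if n = Fin.cons 1 m then f n else 0) := by
    intro n
    unfold pairCoeff
    split_ifs <;> ring
  simp_rw [this]
  rw [← Finset.mul_sum, Finset.sum_add_distrib, Finset.sum_ite_eq_of_mem' _ _ _ h0,
    Finset.sum_ite_eq_of_mem' _ _ _ h1]

theorem inv_sqrt_two_mul_self : ((√2)⁻¹ : ℝ) * (√2)⁻¹ = 1 / 2 := by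
  rw [← mul_inv, Real.mul_self_sqrt (by norm_num), one_div]

theorem sum_conj_pairCoeff_mul {k N : ℕ} (hN : 1 ≤ N) {m m' : Fin k → ℤ} (hm' : m' ∈ boxD k N) :
    ∑ n ∈ boxD (k + 1) N, (starRingEnd ℂ) (pairCoeff k m n) * pairCoeff k m' n
      = if m = m' then 1 else 0 := by
  rw [sum_mul_pairCoeff hN hm' fun n => (starRingEnd ℂ) (pairCoeff k m n)]
  have h2 : (((√2)⁻¹ : ℝ) : ℂ) * ((√2)⁻¹ : ℝ) = 1 / 2 := by
    rw [← Complex.ofReal_mul, inv_sqrt_two_mul_self]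
    norm_num
  simp only [pairCoeff, Fin.cons_inj, map_mul, Complex.conj_ofReal]
  by_cases h : m = m'
  · subst h
    simp only [and_self, and_true, if_true, zero_ne_one, one_ne_zero, if_false, add_zero,
      zero_add, map_one, mul_one]
    linear_combination 2 * h2
  · simp [h, Ne.symm h]

theorem norm_sq_one_add_exp (θ : ℝ) :
    ‖1 + Complex.exp (θ * Complex.I)‖ ^ 2 = 2 * (1 + Real.cos θ) := by
  rw [← Complex.normSq_eq_norm_sq, Complex.normSq_apply]
  simp only [Complex.add_re, Complex.add_im, Complex.one_re, Complex.one_im,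
    Complex.exp_ofReal_mul_I_re, Complex.exp_ofReal_mul_I_im]
  nlinarith [Real.sin_sq_add_cos_sq θ]

theorem norm_sq_UtrigD_pairCoeff {k N : ℕ} (hN : 1 ≤ N) {m : Fin k → ℤ} (hm : m ∈ boxD k N)
    (t : ℝ) (x : Fin (k + 1) → ℝ) :
    ‖UtrigD (k + 1) N (pairCoeff k m) t x‖ ^ 2
      = (2 * Real.pi) ^ (-((k + 1 : ℕ) : ℝ)) * (1 + Real.cos (x 0 - t)) := by
  have h : UtrigD (k + 1) N (pairCoeff k m) t x
      = ((√2)⁻¹ : ℝ) * ((((2 * Real.pi) ^ (-((k + 1 : ℕ) : ℝ) / 2) : ℝ) : ℂ) *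
        (Complex.exp (((∑ i, (m i : ℝ) * x i.succ - t * ∑ i, (m i : ℝ) ^ 2 : ℝ) : ℂ) * Complex.I)
          * (1 + Complex.exp ((x 0 - t : ℝ) * Complex.I)))) := by
    have h1 : UtrigD (k + 1) N (pairCoeff k m) t x = ∑ n ∈ boxD (k + 1) N,
        (Complex.exp (((-(t * ∑ i, ((n i : ℝ)) ^ 2) : ℝ) : ℂ) * Complex.I)
          * eFunD (k + 1) n x) * pairCoeff k m n :=
      Finset.sum_congr rfl fun n _ => by ring
    rw [h1, sum_mul_pairCoeff hN hm fun n =>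
      Complex.exp (((-(t * ∑ i, ((n i : ℝ)) ^ 2) : ℝ) : ℂ) * Complex.I) * eFunD (k + 1) n x]
    congr 1
    simp only [eFunD, mul_add, mul_one]
    congr 1
    · rw [mul_left_comm, ← Complex.exp_add]
      congr 2
      simp only [Fin.sum_univ_succ, Fin.cons_zero, Fin.cons_succ]
      push_cast
      ring
    · rw [mul_left_comm, ← Complex.exp_add, ← Complex.exp_add]
      congr 2
      simp only [Fin.sum_univ_succ, Fin.cons_zero, Fin.cons_succ]
      push_cast
      ring
  rw [h, norm_mul, norm_mul, norm_mul, Complex.norm_exp_ofReal_mul_I, one_mul, mul_pow, mul_pow,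
    norm_sq_one_add_exp, Complex.norm_real, Complex.norm_real, Real.norm_eq_abs,
    Real.norm_eq_abs, sq_abs, sq_abs, two_pi_rpow_sq, sq, inv_sqrt_two_mul_self]
  ring

theorem eLpNorm_cos_sub_ne_zero (k : ℕ) {p : ℝ≥0∞} (hp : p ≠ 0) :
    eLpNorm (fun q : ℝ × (Fin (k + 1) → ℝ) => Real.cos (q.2 0 - q.1)) p
      ((volume.restrict (Set.Ioc 0 (2 * Real.pi))).prod (torusMeasureD (k + 1))) ≠ 0 := by
  have hc : Continuous fun q : ℝ × (Fin (k + 1) → ℝ) => Real.cos (q.2 0 - q.1) := by fun_prop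
  rw [Ne, eLpNorm_eq_zero_iff hc.aestronglyMeasurable hp]
  intro h
  have hsub : (Set.Ioo (0 : ℝ) 1) ×ˢ (Set.univ.pi fun _ : Fin (k + 1) => Set.Ioo (0 : ℝ) 1)
      ⊆ {q | ¬ Real.cos (q.2 0 - q.1) = 0} := by
    rintro ⟨t, x⟩ ⟨ht, hx⟩
    have hx0 := hx 0 (Set.mem_univ _)
    simp only [Set.mem_Ioo] at ht hx0
    refine (Real.cos_pos_of_mem_Ioo ⟨?_, ?_⟩).ne' <;> simp only <;>
      linarith [Real.pi_gt_three]
  have h0 := measure_mono_null hsub h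
  have h1 : (volume.restrict (Set.Ioc 0 (2 * Real.pi))) (Set.Ioo (0 : ℝ) 1) = 1 := by
    rw [Measure.restrict_apply measurableSet_Ioo, Set.inter_eq_left.mpr, Real.volume_Ioo]
    · simp
    · intro y hy
      exact ⟨hy.1, by linarith [hy.2, Real.pi_gt_three]⟩
  rw [Measure.prod_prod, torusMeasureD, Measure.pi_pi] at h0
  simp [h1] at h0

theorem le_of_forall_mul_rpow_le {c C β σ : ℝ} (hc : 0 < c)
    (h : ∀ N : ℕ, 1 ≤ N → c * (N : ℝ) ^ β ≤ C * (N : ℝ) ^ σ) : β ≤ σ := by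
  by_contra! hlt
  have ht := (tendsto_rpow_atTop (sub_pos.mpr hlt)).comp (tendsto_natCast_atTop_atTop (R := ℝ))
  obtain ⟨N, hN, hN1⟩ :=
    ((ht.eventually_gt_atTop (C / c)).and (Filter.eventually_ge_atTop 1)).exists
  have hNpos : (0 : ℝ) < N := by exact_mod_cast hN1
  have hσ := Real.rpow_pos_of_pos hNpos σ
  simp only [Function.comp_apply, Real.rpow_sub hNpos, div_lt_div_iff₀ hc hσ] at hN
  linarith [h N hN1]

/-- Necessity on `𝕋^d`, `d ≥ 2`: if the renormalised orthonormal Strichartz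
estimate `‖ρ̄(U(t)γ₀U*(t))‖_{L^{p*}([0,2π]×𝕋^d)} ≤ C N^σ ‖γ₀‖_{S^α}` (with `p* = (d+2)/d`)
holds for all frequency-`≤ N` trigonometric-polynomial orthonormal systems,
then `1/α ≥ 1 - σ/(d-1)`. -/
theorem stmt18 (d : ℕ) (hd : 2 ≤ d) (σ α C : ℝ)
    (hσ0 : 0 < σ) (hσ1 : σ ≤ (d : ℝ) / ((d : ℝ) + 2)) (hα : 1 ≤ α) (hC : 0 < C)
    (H : ∀ N : ℕ, 1 ≤ N → ∀ J : ℕ, ∀ c : Fin J → (Fin d → ℤ) → ℂ, ∀ a : Fin J → ℝ,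
      (∀ j, 0 ≤ a j) →
      (∀ i j, (∫ x, (starRingEnd ℂ) (UtrigD d N (c i) 0 x) * UtrigD d N (c j) 0 x
          ∂torusMeasureD d) = if i = j then 1 else 0) →
      eLpNorm (fun q : ℝ × (Fin d → ℝ) =>
          (∑ j, a j * ‖UtrigD d N (c j) q.1 q.2‖ ^ 2) - (2 * Real.pi) ^ (-(d : ℝ)) * ∑ j, a j)
        (ENNReal.ofReal (((d : ℝ) + 2) / (d : ℝ)))
        ((volume.restrict (Set.Ioc 0 (2 * Real.pi))).prod (torusMeasureD d))
        ≤ ENNReal.ofReal (C * (N : ℝ) ^ σ * (∑ j, a j ^ α) ^ (1 / α))) :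
    1 / α ≥ 1 - σ / ((d : ℝ) - 1) := by
  obtain ⟨k, rfl⟩ : ∃ k, d = k + 1 := ⟨d - 1, by omega⟩
  have hk : (0 : ℝ) < k := by
    have : 1 ≤ k := by omega
    exact_mod_cast this
  set p : ℝ≥0∞ := ENNReal.ofReal ((((k + 1 : ℕ) : ℝ) + 2) / ((k + 1 : ℕ) : ℝ)) with hp_def
  have hp : p ≠ 0 := by
    rw [hp_def, Ne, ENNReal.ofReal_eq_zero, not_le]
    positivity
  set μ := (volume.restrict (Set.Ioc 0 (2 * Real.pi))).prod (torusMeasureD (k + 1)) with hμ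
  set g : ℝ × (Fin (k + 1) → ℝ) → ℝ := fun q => Real.cos (q.2 0 - q.1) with hg
  have hK : min (eLpNorm g p μ) 1 ≠ 0 :=
    (lt_min (pos_iff_ne_zero.mpr (eLpNorm_cos_sub_ne_zero k hp)) one_pos).ne'
  have hK' : min (eLpNorm g p μ) 1 ≠ ⊤ := ne_top_of_le_ne_top ENNReal.one_ne_top (min_le_right _ _)
  set K : ℝ := (min (eLpNorm g p μ) 1).toReal with hKdef
  have hKpos : 0 < K := ENNReal.toReal_pos hK hK'
  set w : ℝ := (2 * Real.pi) ^ (-((k + 1 : ℕ) : ℝ)) with hw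
  have hwpos : 0 < w := by positivity
  have key : ∀ N : ℕ, 1 ≤ N →
      w * K * ((2 * N + 1 : ℝ) ^ k) ≤ C * (N : ℝ) ^ σ * ((2 * N + 1 : ℝ) ^ k) ^ (1 / α) := by
    intro N hN
    have hM : ((boxD k N).card : ℝ) = (2 * N + 1 : ℝ) ^ k := by
      rw [card_boxD]
      push_cast
      rfl
    have hH := H N hN (boxD k N).card (fun j => pairCoeff k ((boxD k N).equivFin.symm j))
      (fun _ => 1) (fun _ => zero_le_one) (fun i j => by
        rw [integral_conj_UtrigD_mul, sum_conj_pairCoeff_mul hN (Subtype.prop _)]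
        simp only [Subtype.coe_inj, EmbeddingLike.apply_eq_iff_eq])
    have hfun : (fun q : ℝ × (Fin (k + 1) → ℝ) =>
        (∑ j : Fin (boxD k N).card, (1 : ℝ) * ‖UtrigD (k + 1) N
          (pairCoeff k ((boxD k N).equivFin.symm j)) q.1 q.2‖ ^ 2)
          - w * ∑ _j : Fin (boxD k N).card, (1 : ℝ))
        = (w * (2 * N + 1 : ℝ) ^ k) • g := by
      ext q
      simp_rw [norm_sq_UtrigD_pairCoeff hN (Subtype.prop _)]
      simp only [Finset.sum_const, Finset.card_univ, Fintype.card_fin, nsmul_eq_mul, hM,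
        Pi.smul_apply, smul_eq_mul, hg, ← hw]
      ring
    rw [hfun, eLpNorm_const_smul, Real.enorm_of_nonneg (by positivity)] at hH
    simp only [Real.one_rpow, Finset.sum_const, Finset.card_univ, Fintype.card_fin, nsmul_eq_mul,
      hM, mul_one] at hH
    have h2 : ENNReal.ofReal (w * (2 * N + 1 : ℝ) ^ k * K)
        ≤ ENNReal.ofReal (C * (N : ℝ) ^ σ * ((2 * N + 1 : ℝ) ^ k) ^ (1 / α)) := by
      refine le_trans ?_ hH
      rw [ENNReal.ofReal_mul (by positivity), hKdef, ENNReal.ofReal_toReal hK']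
      gcongr
      exact min_le_left _ _
    rw [ENNReal.ofReal_le_ofReal_iff (by positivity)] at h2
    linarith
  have hβ : 0 ≤ 1 - 1 / α := by
    rw [sub_nonneg, div_le_one (by linarith)]
    exact hα
  have hfin : (k : ℝ) * (1 - 1 / α) ≤ σ := by
    refine le_of_forall_mul_rpow_le (mul_pos hwpos hKpos) (C := C) fun N hN => ?_
    set M : ℝ := (2 * N + 1 : ℝ) ^ k with hM
    have hMpos : 0 < M := by positivity
    have hNM : (N : ℝ) ^ k ≤ M := by
      rw [hM]
      gcongr
      linarith [(Nat.cast_nonneg N : (0 : ℝ) ≤ N)]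
    have h1 : (N : ℝ) ^ ((k : ℝ) * (1 - 1 / α)) ≤ M ^ (1 - 1 / α) := by
      rw [Real.rpow_mul (by positivity), Real.rpow_natCast]
      exact Real.rpow_le_rpow (by positivity) hNM hβ
    have h2 : w * K * M ^ (1 - 1 / α) ≤ C * (N : ℝ) ^ σ := by
      rw [Real.rpow_sub hMpos, Real.rpow_one, mul_div_assoc', div_le_iff₀ (by positivity)]
      exact key N hN
    exact (mul_le_mul_of_nonneg_left h1 (by positivity)).trans h2
  have hcast : ((k + 1 : ℕ) : ℝ) - 1 = k := by
    push_cast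
    ring
  rw [hcast, ge_iff_le, sub_le_comm, le_div_iff₀ hk]
  linarith

end
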